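/- arXiv:2012.00345 — 2 statements merged into one kernel-verified Lean document; each statement's English description precedes it below -/
import Mathlib

section
/- The supremum of the objective value over all φ-feasible quantile functions G equals max(1/δ, γ̃*)·x (with the convention that both sides equal +∞ when γ̃* = +∞). -/
open MeasureTheory Set Filter Topology ENNReal

noncomputable section

/-- A φ-feasible quantile function for weight function `φ` and initial wealth `x`:
nondecreasing and right-continuous on `(0,1)`, with `lim_{z↓0} G(z) ≥ 0`, satisfying the
budget constraint `∫_0^1 φ(z) G(z) dz ≤ x`. -/
def FeasibleW (φ : ℝ → ℝ) (x : ℝ) (G : ℝ → ℝ) : Prop :=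
  MonotoneOn G (Set.Ioo 0 1)
  ∧ (∀ z ∈ Set.Ioo (0:ℝ) 1, Filter.Tendsto G (nhdsWithin z (Set.Ioi z)) (nhds (G z)))
  ∧ (∃ L, 0 ≤ L ∧ Filter.Tendsto G (nhdsWithin 0 (Set.Ioi 0)) (nhds L))
  ∧ ∫⁻ z in Set.Ioo (0:ℝ) 1, ENNReal.ofReal (φ z * G z) ≤ ENNReal.ofReal x

/-- The extension `Ḡ` of a (nonnegative) quantile function `G` from `(0,1)` to `[0,1]`,
valued in `[0,∞]`, with `Ḡ(0) = lim_{z↓0} G(z)` and `Ḡ(1) = lim_{z↑1} G(z)`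
(these limits are the inf/sup over `(0,1)` since `G` is nondecreasing). -/
def Gbar (G : ℝ → ℝ) : ℝ → ℝ≥0∞ := fun z =>
  if z = 0 then ⨅ y ∈ Set.Ioo (0:ℝ) 1, ENNReal.ofReal (G y)
  else if z = 1 then ⨆ y ∈ Set.Ioo (0:ℝ) 1, ENNReal.ofReal (G y)
  else ENNReal.ofReal (G z)

/-- The objective value `∫_{[0,1]} Ḡ(z) m(dz)` of a quantile function `G`
(for `m` a Borel probability measure carried by `[0,1]`). -/
def objVal (m : Measure ℝ) (G : ℝ → ℝ) : ℝ≥0∞ := ∫⁻ z, Gbar G z ∂m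

/-- `ζ̃(c) = m([c,1]) / ∫_c^1 φ(z) dz`. -/
def zetaW (φ : ℝ → ℝ) (m : Measure ℝ) (c : ℝ) : ℝ :=
  (m (Set.Icc c 1)).toReal / ∫ z in c..1, φ z

/-- If every superlevel set of `f` has `μ`-measure at most `K` times its `ν`-measure, then
the same inequality holds between the integrals of `f`. -/
lemma lintegral_le_mul_of_measure_superlevel_le {α : Type*} [MeasurableSpace α]
    {μ ν : Measure α} {f : α → ℝ≥0∞} (hf : Measurable f) {K : ℝ≥0∞}
    (h : ∀ t : ℝ, 0 < t → μ {a | ENNReal.ofReal t < f a} ≤ K * ν {a | ENNReal.ofReal t < f a}) :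
    ∫⁻ a, f a ∂μ ≤ K * ∫⁻ a, f a ∂ν := by
  have hsup : ∀ a, f a = ⨆ n : ℕ, min (f a) n := fun a => by
    rw [← inf_iSup_eq, ENNReal.iSup_natCast, inf_top_eq]
  have hmeas : ∀ n : ℕ, Measurable fun a => min (f a) n := fun n => hf.min measurable_const
  have hmono : Monotone fun (n : ℕ) a => min (f a) n := fun i j hij a =>
    min_le_min le_rfl (by exact_mod_cast hij)
  calc ∫⁻ a, f a ∂μ = ⨆ n : ℕ, ∫⁻ a, min (f a) n ∂μ := by
        rw [← lintegral_iSup hmeas hmono]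
        exact lintegral_congr hsup
    _ ≤ K * ∫⁻ a, f a ∂ν := iSup_le fun n => ?_
  have hne : ∀ a, min (f a) n ≠ ∞ := fun a =>
    ((min_le_right _ _).trans_lt (ENNReal.natCast_lt_top n)).ne
  have hreal : Measurable fun a => (min (f a) n).toReal := (hmeas n).ennreal_toReal
  have hcake : ∀ ρ : Measure α, ∫⁻ a, min (f a) n ∂ρ
      = ∫⁻ t in Ioi (0 : ℝ), ρ {a | t < (min (f a) n).toReal} := fun ρ => by
    rw [← lintegral_eq_lintegral_meas_lt ρ (Eventually.of_forall fun _ => ENNReal.toReal_nonneg)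
      hreal.aemeasurable]
    exact lintegral_congr fun a => (ENNReal.ofReal_toReal (hne a)).symm
  have hlevel : ∀ t : ℝ, 0 < t →
      μ {a | t < (min (f a) n).toReal} ≤ K * ν {a | t < (min (f a) n).toReal} := by
    intro t ht
    have hset : {a | t < (min (f a) n).toReal}
        = {a | ENNReal.ofReal t < f a ∧ ENNReal.ofReal t < n} := by
      ext a
      simp only [mem_ofPred_eq]
      rw [← ENNReal.ofReal_lt_iff_lt_toReal ht.le (hne a), lt_min_iff]
    rw [hset]
    by_cases hn : ENNReal.ofReal t < n
    · simpa [hn] using h t ht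
    · simp [hn]
  have hanti : Antitone fun t : ℝ => ν {a | t < (min (f a) n).toReal} :=
    fun s t hst => measure_mono fun a (ha : t < _) => hst.trans_lt ha
  calc ∫⁻ a, min (f a) n ∂μ
      ≤ ∫⁻ t in Ioi (0 : ℝ), K * ν {a | t < (min (f a) n).toReal} := by
        rw [hcake]
        exact setLIntegral_mono (hanti.measurable.const_mul K) hlevel
    _ = K * ∫⁻ a, min (f a) n ∂ν := by
        rw [lintegral_const_mul _ hanti.measurable, hcake]
    _ ≤ K * ∫⁻ a, f a ∂ν := by
        gcongr
        exact min_le_left _ _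

/-- The extension of a nondecreasing function on `(0,1)` is nondecreasing on `[0,1]`. -/
lemma monotoneOn_Gbar {G : ℝ → ℝ} (hG : MonotoneOn G (Ioo 0 1)) :
    MonotoneOn (Gbar G) (Icc 0 1) := by
  intro a ha b hb hab
  rcases eq_or_lt_of_le hab with rfl | hab
  · exact le_rfl
  have ha1 : a < 1 := hab.trans_le hb.2
  have hb0 : 0 < b := ha.1.trans_lt hab
  unfold Gbar
  rw [if_neg ha1.ne, if_neg hb0.ne']
  split_ifs with h0 h1 h1
  · exact (iInf₂_le (1 / 2 : ℝ) (by norm_num)).trans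
      (le_iSup₂ (f := fun y (_ : y ∈ Ioo (0 : ℝ) 1) => ENNReal.ofReal (G y)) (1 / 2 : ℝ)
        (by norm_num))
  · exact iInf₂_le b ⟨hb0, lt_of_le_of_ne hb.2 h1⟩
  · exact le_iSup₂ (f := fun y (_ : y ∈ Ioo (0 : ℝ) 1) => ENNReal.ofReal (G y)) a
      ⟨lt_of_le_of_ne ha.1 (Ne.symm h0), ha1⟩
  · exact ENNReal.ofReal_le_ofReal (hG ⟨lt_of_le_of_ne ha.1 (Ne.symm h0), ha1⟩
      ⟨hb0, lt_of_le_of_ne hb.2 h1⟩ hab.le)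

lemma Gbar_of_mem_Ioo {G : ℝ → ℝ} {z : ℝ} (hz : z ∈ Ioo (0 : ℝ) 1) :
    Gbar G z = ENNReal.ofReal (G z) := by
  simp [Gbar, hz.1.ne', hz.2.ne]

/-- A superlevel set containing `1` meets the open interval `(0,1)`. -/
lemma exists_lt_Gbar_of_lt_Gbar_one {G : ℝ → ℝ} {t : ℝ≥0∞} (ht : t < Gbar G 1) :
    ∃ y ∈ Ioo (0 : ℝ) 1, t < Gbar G y := by
  rw [Gbar, if_neg one_ne_zero, if_pos rfl] at ht
  obtain ⟨y, hy⟩ := lt_iSup_iff.1 ht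
  obtain ⟨hy, hty⟩ := lt_iSup_iff.1 hy
  exact ⟨y, hy, by rwa [Gbar_of_mem_Ioo hy]⟩

lemma measurable_indicator_of_monotoneOn {f : ℝ → ℝ≥0∞} {s : Set ℝ} (hs : s.OrdConnected)
    (hf : MonotoneOn f s) : Measurable (s.indicator f) := by
  refine measurable_of_Ioi fun t => ?_
  have : s.indicator f ⁻¹' Ioi t = {z | z ∈ s ∧ t < f z} := by
    ext z
    by_cases hz : z ∈ s <;> simp [hz]
  rw [this]
  refine OrdConnected.measurableSet ⟨fun a ha b hb c hc => ?_⟩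
  have hcs := hs.out ha.1 hb.1 hc
  exact ⟨hcs, ha.2.trans_le (hf ha.1 hcs hc.1)⟩

/-- Bounds on the measures of the intervals `[c,1]` pass to the superlevel sets of `Gbar G`. -/
lemma measure_superlevel_Gbar_le {m μ : Measure ℝ} [IsProbabilityMeasure m] {K : ℝ≥0∞}
    (h0 : 1 ≤ K * μ (Ioo 0 1)) (hc : ∀ c ∈ Ioo (0 : ℝ) 1, m (Icc c 1) ≤ K * μ (Ico c 1))
    {G : ℝ → ℝ} (hG : MonotoneOn G (Ioo 0 1)) (t : ℝ≥0∞) :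
    m {z | t < (Icc (0 : ℝ) 1).indicator (Gbar G) z}
      ≤ K * μ {z | t < (Icc (0 : ℝ) 1).indicator (Gbar G) z} := by
  have hmono := monotoneOn_Gbar hG
  set U := {z | t < (Icc (0 : ℝ) 1).indicator (Gbar G) z} with hU
  have hmem : ∀ z, z ∈ U ↔ z ∈ Icc (0 : ℝ) 1 ∧ t < Gbar G z := fun z => by
    by_cases hz : z ∈ Icc (0 : ℝ) 1
    · simp only [hU, mem_ofPred_eq, indicator_of_mem hz, hz, true_and]
    · simp only [hU, mem_ofPred_eq, indicator_of_notMem hz, hz, false_and, not_lt_zero]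
  have hUm : MeasurableSet U :=
    measurableSet_lt measurable_const (measurable_indicator_of_monotoneOn ordConnected_Icc hmono)
  have hup : ∀ c ∈ U, ∀ z ∈ Icc c 1, z ∈ U := fun c hcU z hz => by
    have hc' := (hmem c).1 hcU
    have hz' : z ∈ Icc (0 : ℝ) 1 := ⟨hc'.1.1.trans hz.1, hz.2⟩
    exact (hmem z).2 ⟨hz', hc'.2.trans_le (hmono hc'.1 hz' hz.1)⟩
  have hIoo : ∀ c ∈ U ∩ Ioo 0 1, ∀ L : Set ℝ, L ⊆ Icc c 1 → m L ≤ K * μ U := fun c hcU L hL =>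
    calc m L ≤ m (Icc c 1) := measure_mono hL
      _ ≤ K * μ (Ico c 1) := hc c hcU.2
      _ ≤ K * μ U := by
        gcongr
        exact fun z hz => hup c hcU.1 z (Ico_subset_Icc_self hz)
  refine le_of_forall_lt fun r hr => ?_
  obtain ⟨L, hLU, hL, hrL⟩ := hUm.exists_lt_isCompact hr
  refine hrL.trans_le ?_
  rcases L.eq_empty_or_nonempty with rfl | hne
  · simp
  obtain ⟨c, hcL, hcmin⟩ := hL.exists_isLeast hne
  have hcU := hLU hcL
  have hLc : L ⊆ Icc c 1 := fun z hz => ⟨hcmin hz, ((hmem z).1 (hLU hz)).1.2⟩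
  obtain ⟨hc01, htc⟩ := (hmem c).1 hcU
  rcases eq_or_lt_of_le hc01.1 with rfl | hc0
  · calc m L ≤ 1 := prob_le_one
      _ ≤ K * μ (Ioo 0 1) := h0
      _ ≤ K * μ U := by
        gcongr
        exact fun z hz => hup 0 hcU z (Ioo_subset_Icc_self hz)
  rcases eq_or_lt_of_le hc01.2 with rfl | hc1
  · obtain ⟨y, hy, hty⟩ := exists_lt_Gbar_of_lt_Gbar_one htc
    exact hIoo y ⟨(hmem y).2 ⟨Ioo_subset_Icc_self hy, hty⟩, hy⟩ L
      (hLc.trans (Icc_subset_Icc_left hy.2.le))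
  · exact hIoo c ⟨hcU, hc0, hc1⟩ L hLc

lemma setLIntegral_Ioo_eq_ofReal_intervalIntegral {φ : ℝ → ℝ}
    (hφpos : ∀ z ∈ Ioo (0 : ℝ) 1, 0 < φ z) (hφint : IntegrableOn φ (Ioo 0 1))
    {c : ℝ} (hc : c ∈ Ico (0 : ℝ) 1) :
    ∫⁻ z in Ioo c 1, ENNReal.ofReal (φ z) = ENNReal.ofReal (∫ z in c..1, φ z) := by
  have hsub : Ioo c 1 ⊆ Ioo 0 1 := Ioo_subset_Ioo_left hc.1
  rw [intervalIntegral.integral_of_le hc.2.le, integral_Ioc_eq_integral_Ioo,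
    ofReal_integral_eq_lintegral_ofReal (hφint.mono_set hsub)]
  exact (ae_restrict_iff' measurableSet_Ioo).2
    (Eventually.of_forall fun z hz => (hφpos z (hsub hz)).le)

lemma intervalIntegral_weight_pos {φ : ℝ → ℝ}
    (hφpos : ∀ z ∈ Ioo (0 : ℝ) 1, 0 < φ z) (hφint : IntegrableOn φ (Ioo 0 1))
    {c : ℝ} (hc : c ∈ Ico (0 : ℝ) 1) : 0 < ∫ z in c..1, φ z :=
  intervalIntegral.intervalIntegral_pos_of_pos_on
    ((intervalIntegrable_iff_integrableOn_Ioo_of_le hc.2.le).2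
      (hφint.mono_set (Ioo_subset_Ioo_left hc.1)))
    (fun z hz => hφpos z ⟨hc.1.trans_lt hz.1, hz.2⟩) hc.2

lemma lintegral_ofReal_weight_mul {φ : ℝ → ℝ} (hφpos : ∀ z ∈ Ioo (0 : ℝ) 1, 0 < φ z)
    (G : ℝ → ℝ) :
    ∫⁻ z in Ioo (0 : ℝ) 1, ENNReal.ofReal (φ z * G z)
      = ∫⁻ z in Ioo (0 : ℝ) 1, ENNReal.ofReal (φ z) * ENNReal.ofReal (G z) :=
  setLIntegral_congr_fun measurableSet_Ioo fun z hz => ENNReal.ofReal_mul (hφpos z hz).le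

/-- The objective value of a feasible quantile function is at most `K * x` as soon as `K`
dominates `1 / δ` and every `zetaW φ m c`. -/
lemma objVal_le_mul {φ : ℝ → ℝ} (hφmeas : Measurable φ) (hφpos : ∀ z ∈ Ioo (0 : ℝ) 1, 0 < φ z)
    (hφint : IntegrableOn φ (Ioo 0 1)) {m : Measure ℝ} [IsProbabilityMeasure m]
    (hm : m (Icc (0 : ℝ) 1)ᶜ = 0) {x : ℝ} {K : ℝ≥0∞}
    (hK0 : ENNReal.ofReal (1 / ∫ z in (0 : ℝ)..1, φ z) ≤ K)
    (hKc : ∀ c ∈ Ioo (0 : ℝ) 1, ENNReal.ofReal (zetaW φ m c) ≤ K)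
    {G : ℝ → ℝ} (hG : FeasibleW φ x G) : objVal m G ≤ K * ENNReal.ofReal x := by
  obtain ⟨hmono, -, -, hbudget⟩ := hG
  set d : ℝ → ℝ≥0∞ := fun z => ENNReal.ofReal (φ z)
  have hd : Measurable d := hφmeas.ennreal_ofReal
  set μ : Measure ℝ := (volume.restrict (Ioo 0 1)).withDensity d
  set f := (Icc (0 : ℝ) 1).indicator (Gbar G)
  have hf : Measurable f := measurable_indicator_of_monotoneOn ordConnected_Icc
    (monotoneOn_Gbar hmono)
  have hI0 := intervalIntegral_weight_pos hφpos hφint (c := 0) (by norm_num)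
  have hμ0 : μ (Ioo 0 1) = ENNReal.ofReal (∫ z in (0 : ℝ)..1, φ z) := by
    rw [withDensity_apply _ measurableSet_Ioo, Measure.restrict_restrict measurableSet_Ioo,
      inter_self, setLIntegral_Ioo_eq_ofReal_intervalIntegral hφpos hφint (by norm_num)]
  have hμc : ∀ c ∈ Ioo (0 : ℝ) 1, ENNReal.ofReal (∫ z in c..1, φ z) ≤ μ (Ico c 1) := by
    intro c hc
    rw [← setLIntegral_Ioo_eq_ofReal_intervalIntegral hφpos hφint (Ioo_subset_Ico_self hc),
      withDensity_apply _ measurableSet_Ico, Measure.restrict_restrict measurableSet_Ico]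
    exact lintegral_mono_set fun z hz => ⟨Ioo_subset_Ico_self hz, hc.1.trans hz.1, hz.2⟩
  have h0 : 1 ≤ K * μ (Ioo 0 1) := by
    calc (1 : ℝ≥0∞) = ENNReal.ofReal (1 / ∫ z in (0 : ℝ)..1, φ z) * μ (Ioo 0 1) := by
          rw [hμ0, ← ENNReal.ofReal_mul (by positivity), one_div_mul_cancel hI0.ne',
            ENNReal.ofReal_one]
      _ ≤ K * μ (Ioo 0 1) := by gcongr
  have hc : ∀ c ∈ Ioo (0 : ℝ) 1, m (Icc c 1) ≤ K * μ (Ico c 1) := by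
    intro c hc
    have hI := intervalIntegral_weight_pos hφpos hφint (Ioo_subset_Ico_self hc)
    calc m (Icc c 1) = ENNReal.ofReal (zetaW φ m c) * ENNReal.ofReal (∫ z in c..1, φ z) := by
          rw [zetaW, ← ENNReal.ofReal_mul (by positivity), div_mul_cancel₀ _ hI.ne',
            ENNReal.ofReal_toReal (measure_ne_top _ _)]
      _ ≤ K * μ (Ico c 1) := by
        gcongr
        exacts [hKc c hc, hμc c hc]
  calc objVal m G = ∫⁻ z, f z ∂m := by
        refine lintegral_congr_ae ?_
        filter_upwards [measure_eq_zero_iff_ae_notMem.1 hm] with z hz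
        exact (indicator_of_mem (not_not.1 hz) _).symm
    _ ≤ K * ∫⁻ z, f z ∂μ := lintegral_le_mul_of_measure_superlevel_le hf
        fun t _ => measure_superlevel_Gbar_le h0 hc hmono _
    _ = K * ∫⁻ z in Ioo (0 : ℝ) 1, ENNReal.ofReal (φ z * G z) := by
        rw [lintegral_withDensity_eq_lintegral_mul _ hd hf, lintegral_ofReal_weight_mul hφpos]
        congr 1
        refine setLIntegral_congr_fun measurableSet_Ioo fun z hz => ?_
        simp only [Pi.mul_apply, f, d, indicator_of_mem (Ioo_subset_Icc_self hz),
          Gbar_of_mem_Ioo hz]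
    _ ≤ K * ENNReal.ofReal x := by gcongr

lemma feasibleW_const {φ : ℝ → ℝ} (hφpos : ∀ z ∈ Ioo (0 : ℝ) 1, 0 < φ z)
    (hφint : IntegrableOn φ (Ioo 0 1)) {x : ℝ} (hx : 0 < x) :
    FeasibleW φ x fun _ => x / ∫ z in (0 : ℝ)..1, φ z := by
  have hI := intervalIntegral_weight_pos hφpos hφint (c := 0) (by norm_num)
  refine ⟨monotoneOn_const, fun _ _ => tendsto_const_nhds,
    ⟨_, by positivity, tendsto_const_nhds⟩, ?_⟩
  rw [lintegral_ofReal_weight_mul hφpos, lintegral_mul_const' _ _ ENNReal.ofReal_ne_top,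
    setLIntegral_Ioo_eq_ofReal_intervalIntegral hφpos hφint (by norm_num),
    ← ENNReal.ofReal_mul hI.le, mul_div_cancel₀ _ hI.ne']

lemma objVal_const (m : Measure ℝ) [IsProbabilityMeasure m] (r : ℝ) :
    objVal m (fun _ => r) = ENNReal.ofReal r := by
  have hne : (Ioo (0 : ℝ) 1).Nonempty := ⟨1 / 2, by norm_num⟩
  have : Gbar (fun _ => r) = fun _ => ENNReal.ofReal r := by
    funext z
    unfold Gbar
    rw [biInf_const hne, biSup_const hne]
    simp
  rw [objVal, this, lintegral_const, measure_univ, mul_one]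

lemma feasibleW_indicator {φ : ℝ → ℝ} (hφpos : ∀ z ∈ Ioo (0 : ℝ) 1, 0 < φ z)
    (hφint : IntegrableOn φ (Ioo 0 1)) {x : ℝ} (hx : 0 < x) {c : ℝ} (hc : c ∈ Ioo (0 : ℝ) 1) :
    FeasibleW φ x ((Ici c).indicator fun _ => x / ∫ z in c..1, φ z) := by
  have hI := intervalIntegral_weight_pos hφpos hφint (Ioo_subset_Ico_self hc)
  set r := x / ∫ z in c..1, φ z with hr
  have hr0 : 0 ≤ r := by positivity
  refine ⟨fun a _ b _ hab => ?_, fun z _ => ?_, ⟨0, le_rfl, ?_⟩, ?_⟩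
  · by_cases ha : a ∈ Ici c
    · rw [indicator_of_mem ha, indicator_of_mem (show b ∈ Ici c from le_trans ha hab)]
    · rw [indicator_of_notMem ha]
      exact indicator_nonneg (fun _ _ => hr0) b
  · rcases lt_or_ge z c with hz | hz
    · rw [indicator_of_notMem (by simpa using hz)]
      refine tendsto_const_nhds.congr' ?_
      filter_upwards [mem_nhdsWithin_of_mem_nhds (Iio_mem_nhds hz)] with y hy
      rw [indicator_of_notMem (by simpa using hy)]
    · rw [indicator_of_mem (show z ∈ Ici c from hz)]
      refine tendsto_const_nhds.congr' ?_
      filter_upwards [self_mem_nhdsWithin] with y hy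
      rw [indicator_of_mem (show y ∈ Ici c from hz.trans (le_of_lt hy))]
  · refine tendsto_const_nhds.congr' ?_
    filter_upwards [mem_nhdsWithin_of_mem_nhds (Iio_mem_nhds hc.1)] with y hy
    rw [indicator_of_notMem (by simpa using hy)]
  · have hind : ∀ z, ENNReal.ofReal (φ z * (Ici c).indicator (fun _ => r) z)
        = (Ici c).indicator (fun z => ENNReal.ofReal (φ z * r)) z := fun z => by
      by_cases hz : z ∈ Ici c <;> simp [hz]
    have hinter : Ici c ∩ Ioo 0 1 = Ico c 1 := by
      ext z
      exact ⟨fun h => ⟨h.1, h.2.2⟩, fun h => ⟨h.1, hc.1.trans_le h.1, h.2⟩⟩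
    simp_rw [hind]
    rw [lintegral_indicator measurableSet_Ici, Measure.restrict_restrict measurableSet_Ici, hinter,
      setLIntegral_congr Ioo_ae_eq_Ico.symm]
    simp_rw [ENNReal.ofReal_mul' hr0]
    rw [lintegral_mul_const' _ _ ENNReal.ofReal_ne_top,
      setLIntegral_Ioo_eq_ofReal_intervalIntegral hφpos hφint (Ioo_subset_Ico_self hc),
      ← ENNReal.ofReal_mul hI.le, mul_div_cancel₀ _ hI.ne']

lemma mul_measure_Icc_le_objVal_indicator (m : Measure ℝ) (r : ℝ) {c : ℝ}
    (hc : c ∈ Ioo (0 : ℝ) 1) :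
    ENNReal.ofReal r * m (Icc c 1) ≤ objVal m ((Ici c).indicator fun _ => r) := by
  rw [← setLIntegral_const, ← lintegral_indicator measurableSet_Icc]
  refine lintegral_mono fun z => indicator_le' (fun z hz => ?_) (fun _ _ => zero_le) z
  rcases eq_or_lt_of_le hz.2 with rfl | hz1
  · rw [Gbar, if_neg one_ne_zero, if_pos rfl]
    refine le_iSup₂_of_le c hc ?_
    rw [indicator_of_mem self_mem_Ici]
  · rw [Gbar_of_mem_Ioo ⟨hc.1.trans_le hz.1, hz1⟩, indicator_of_mem (mem_Ici.2 hz.1)]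

/-- the supremum of the objective value over all φ-feasible quantile
functions equals `max(1/δ, γ̃*)·x` (in `[0,∞]`; both sides are `+∞` when `γ̃* = +∞`). -/
theorem iSup_objVal_eq_max_phi
    (φ : ℝ → ℝ) (hφmeas : Measurable φ) (hφpos : ∀ z ∈ Set.Ioo (0:ℝ) 1, 0 < φ z)
    (hφint : IntegrableOn φ (Set.Ioo 0 1))
    (δ : ℝ) (hδ : δ = ∫ z in (0:ℝ)..1, φ z) (hδpos : 0 < δ)
    (m : Measure ℝ) [IsProbabilityMeasure m] (hm : m (Set.Icc (0:ℝ) 1)ᶜ = 0)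
    (x : ℝ) (hx : 0 < x) :
    (⨆ (G : ℝ → ℝ) (_ : FeasibleW φ x G), objVal m G)
      = max (ENNReal.ofReal (1 / δ))
          (⨆ c ∈ Set.Ioo (0:ℝ) 1, ENNReal.ofReal (zetaW φ m c)) * ENNReal.ofReal x := by
  subst hδ
  refine le_antisymm (iSup₂_le fun G hG => objVal_le_mul hφmeas hφpos hφint hm
    (le_max_left _ _) (fun c hc => le_max_of_le_right
      (le_iSup₂ (f := fun c (_ : c ∈ Ioo (0 : ℝ) 1) => ENNReal.ofReal (zetaW φ m c)) c hc)) hG) ?_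
  rw [max_mul_of_nonneg _ _ (zero_le), max_le_iff]
  constructor
  · refine le_iSup₂_of_le _ (feasibleW_const hφpos hφint hx) ?_
    rw [objVal_const, ← ENNReal.ofReal_mul (by positivity), one_div_mul_eq_div]
  · simp_rw [ENNReal.iSup_mul]
    refine iSup₂_le fun c hc => le_iSup₂_of_le _ (feasibleW_indicator hφpos hφint hx hc) ?_
    refine le_trans (le_of_eq ?_) (mul_measure_Icc_le_objVal_indicator m _ hc)
    have hI := intervalIntegral_weight_pos hφpos hφint (Ioo_subset_Ico_self hc)
    rw [zetaW, ← ENNReal.ofReal_toReal (measure_ne_top m (Icc c 1)),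
      ← ENNReal.ofReal_mul (by positivity), ← ENNReal.ofReal_mul (by positivity),
      ENNReal.toReal_ofReal ENNReal.toReal_nonneg]
    congr 1
    ring
end
end

section
/- Suppose m is the Dirac point mass at α ∈ (0,1). Then ζ̃(c) = 1_{c ≤ α} / ∫_c^1 φ(z) dz for all c ∈ (0,1), γ̃* = ζ̃(α) = 1 / ∫_α^1 φ(z) dz > 1/δ, and the function G*(z) := k*·1_{z ≥ α} on (0,1) with k* := x / ∫_α^1 φ(z) dz is a φ-feasible quantile function whose objective value equals k* and is greater than or equal to that of every φ-feasible quantile function; i.e., it is optimal. -/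
open MeasureTheory Set Filter Topology ENNReal

noncomputable section

theorem lintegral_Ioo_ofReal_mul_const {φ : ℝ → ℝ} (hφmeas : Measurable φ)
    (hφpos : ∀ z ∈ Set.Ioo (0:ℝ) 1, 0 < φ z) (hφint : IntegrableOn φ (Set.Ioo 0 1))
    {α : ℝ} (hα : α ∈ Set.Ioo (0:ℝ) 1) (k : ℝ) :
    ∫⁻ z in Set.Ioo α 1, ENNReal.ofReal (φ z * k)
      = ENNReal.ofReal ((∫ t in α..1, φ t) * k) := by
  have hsub : Set.Ioo α 1 ⊆ Set.Ioo (0:ℝ) 1 := Set.Ioo_subset_Ioo_left hα.1.le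
  have hnn : ∀ᵐ z ∂volume.restrict (Set.Ioo α 1), 0 ≤ φ z :=
    (ae_restrict_mem measurableSet_Ioo).mono fun z hz => (hφpos z (hsub hz)).le
  rw [setLIntegral_congr_fun (g := fun z => ENNReal.ofReal (φ z) * ENNReal.ofReal k)
      measurableSet_Ioo fun z hz => ENNReal.ofReal_mul (hφpos z (hsub hz)).le,
    lintegral_mul_const _ hφmeas.ennreal_ofReal,
    ← ofReal_integral_eq_lintegral_ofReal (hφint.mono_set hsub) hnn,
    intervalIntegral.integral_of_le hα.2.le, integral_Ioc_eq_integral_Ioo,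
    ENNReal.ofReal_mul (integral_nonneg_of_ae hnn)]

theorem intervalIntegral_to_one_lt {φ : ℝ → ℝ} (hφpos : ∀ z ∈ Set.Ioo (0:ℝ) 1, 0 < φ z)
    (hφint : IntegrableOn φ (Set.Ioo 0 1)) {a b : ℝ} (ha : 0 ≤ a) (hab : a < b) (hb : b ≤ 1) :
    ∫ t in b..1, φ t < ∫ t in a..1, φ t := by
  have hi : ∀ u v : ℝ, 0 ≤ u → u ≤ v → v ≤ 1 → IntervalIntegrable φ volume u v :=
    fun u v hu huv hv => (intervalIntegrable_iff_integrableOn_Ioo_of_le huv).2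
      (hφint.mono_set (Set.Ioo_subset_Ioo hu hv))
  have hpos : 0 < ∫ t in a..b, φ t :=
    intervalIntegral.intervalIntegral_pos_of_pos_on (hi a b ha hab.le hb)
      (fun z hz => hφpos z ⟨ha.trans_lt hz.1, hz.2.trans_le hb⟩) hab
  have := intervalIntegral.integral_add_adjacent_intervals (hi a b ha hab.le hb)
    (hi b 1 (ha.trans hab.le) hb le_rfl)
  linarith

theorem feasibleW_step {φ : ℝ → ℝ} (hφmeas : Measurable φ)
    (hφpos : ∀ z ∈ Set.Ioo (0:ℝ) 1, 0 < φ z) (hφint : IntegrableOn φ (Set.Ioo 0 1))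
    {α k x : ℝ} (hα : α ∈ Set.Ioo (0:ℝ) 1) (hk : 0 ≤ k) (hkx : (∫ t in α..1, φ t) * k ≤ x) :
    FeasibleW φ x (fun z => if α ≤ z then k else 0) := by
  refine ⟨?_, ?_, ⟨0, le_rfl, ?_⟩, ?_⟩
  · intro a _ b _ hab
    dsimp only
    split_ifs <;> linarith
  · intro z _
    refine tendsto_const_nhds.congr' ?_
    rcases le_or_gt α z with h | h
    · filter_upwards [self_mem_nhdsWithin] with y hy
      have hy' : z < y := hy
      simp [h, h.trans hy'.le]
    · filter_upwards [mem_nhdsWithin_of_mem_nhds (Iio_mem_nhds h)] with y hy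
      have hy' : y < α := hy
      simp [not_le.2 hy', not_le.2 h]
  · refine tendsto_const_nhds.congr' ?_
    filter_upwards [mem_nhdsWithin_of_mem_nhds (Iio_mem_nhds hα.1)] with y hy
    have hy' : y < α := hy
    simp [hy']
  · have hfun : (fun z => ENNReal.ofReal (φ z * if α ≤ z then k else 0))
        = (Set.Ici α).indicator fun z => ENNReal.ofReal (φ z * k) := by
      ext z
      by_cases h : α ≤ z <;> simp [h]
    have hset : Set.Ici α ∩ Set.Ioo 0 1 = Set.Ico α 1 := by
      ext z
      simp only [Set.mem_inter_iff, Set.mem_Ici, Set.mem_Ioo, Set.mem_Ico]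
      exact ⟨fun h => ⟨h.1, h.2.2⟩, fun h => ⟨h.1, hα.1.trans_le h.1, h.2⟩⟩
    rw [hfun, lintegral_indicator measurableSet_Ici,
      Measure.restrict_restrict measurableSet_Ici, hset,
      ← setLIntegral_congr Ioo_ae_eq_Ico,
      lintegral_Ioo_ofReal_mul_const hφmeas hφpos hφint hα]
    exact ENNReal.ofReal_le_ofReal hkx

theorem FeasibleW.integral_mul_le {φ G : ℝ → ℝ} {x : ℝ} (hG : FeasibleW φ x G)
    (hφmeas : Measurable φ) (hφpos : ∀ z ∈ Set.Ioo (0:ℝ) 1, 0 < φ z)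
    (hφint : IntegrableOn φ (Set.Ioo 0 1)) (hx : 0 ≤ x) {α : ℝ} (hα : α ∈ Set.Ioo (0:ℝ) 1) :
    (∫ t in α..1, φ t) * G α ≤ x := by
  have hsub : Set.Ioo α 1 ⊆ Set.Ioo (0:ℝ) 1 := Set.Ioo_subset_Ioo_left hα.1.le
  rw [← ENNReal.ofReal_le_ofReal_iff hx,
    ← lintegral_Ioo_ofReal_mul_const hφmeas hφpos hφint hα]
  refine le_trans ?_ ((lintegral_mono_set hsub).trans hG.2.2.2)
  refine setLIntegral_mono' measurableSet_Ioo fun z hz => ENNReal.ofReal_le_ofReal ?_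
  exact mul_le_mul_of_nonneg_left (hG.1 hα (hsub hz) hz.1.le) (hφpos z (hsub hz)).le

theorem objVal_dirac {α : ℝ} (hα : α ∈ Set.Ioo (0:ℝ) 1) (G : ℝ → ℝ) :
    objVal (Measure.dirac α) G = ENNReal.ofReal (G α) := by
  simp [objVal, Gbar, hα.1.ne', hα.2.ne]

theorem zetaW_dirac (φ : ℝ → ℝ) {α : ℝ} (hα : α ≤ 1) (c : ℝ) :
    zetaW φ (Measure.dirac α) c = (if c ≤ α then (1:ℝ) else 0) / ∫ t in c..1, φ t := by
  by_cases h : c ≤ α <;> simp [zetaW, h, hα]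

/-- if `m` is the Dirac point mass at `α ∈ (0,1)`, then
`ζ̃(c) = 1_{c ≤ α} / ∫_c^1 φ(z) dz` for all `c ∈ (0,1)`,
`γ̃* = ζ̃(α) = 1 / ∫_α^1 φ(z) dz > 1/δ`, and `G*(z) = k*·1_{z ≥ α}` with
`k* = x / ∫_α^1 φ(z) dz` is a φ-feasible quantile function whose objective value equals
`k*` and which is optimal among φ-feasible quantile functions. -/
theorem quantile_maximization_optimal_phi
    (φ : ℝ → ℝ) (hφmeas : Measurable φ) (hφpos : ∀ z ∈ Set.Ioo (0:ℝ) 1, 0 < φ z)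
    (hφint : IntegrableOn φ (Set.Ioo 0 1))
    (δ : ℝ) (hδ : δ = ∫ z in (0:ℝ)..1, φ z) (hδpos : 0 < δ)
    (x : ℝ) (hx : 0 < x)
    (α : ℝ) (hα : α ∈ Set.Ioo (0:ℝ) 1)
    (m : Measure ℝ) (hmdirac : m = Measure.dirac α) :
    (∀ c ∈ Set.Ioo (0:ℝ) 1,
        zetaW φ m c = (if c ≤ α then (1:ℝ) else 0) / ∫ t in c..1, φ t)
    ∧ (⨆ c ∈ Set.Ioo (0:ℝ) 1, ENNReal.ofReal (zetaW φ m c))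
        = ENNReal.ofReal (zetaW φ m α)
    ∧ zetaW φ m α = 1 / ∫ t in α..1, φ t
    ∧ 1 / δ < zetaW φ m α
    ∧ FeasibleW φ x (fun z => if α ≤ z then x / ∫ t in α..1, φ t else 0)
    ∧ objVal m (fun z => if α ≤ z then x / ∫ t in α..1, φ t else 0)
        = ENNReal.ofReal (x / ∫ t in α..1, φ t)
    ∧ ∀ G : ℝ → ℝ, FeasibleW φ x G →
        objVal m G ≤ objVal m (fun z => if α ≤ z then x / ∫ t in α..1, φ t else 0) := by
  subst hmdirac hδ
  have hI : 0 < ∫ t in α..1, φ t := by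
    simpa using intervalIntegral_to_one_lt hφpos hφint hα.1.le hα.2 le_rfl
  have hζα : zetaW φ (Measure.dirac α) α = 1 / ∫ t in α..1, φ t := by
    simp [zetaW_dirac φ hα.2.le]
  refine ⟨fun c _ => zetaW_dirac φ hα.2.le c, ?_, hζα, ?_, ?_, ?_, ?_⟩
  · refine le_antisymm (iSup₂_le fun c hc => ENNReal.ofReal_le_ofReal ?_)
      (le_iSup₂ (f := fun c (_ : c ∈ Set.Ioo (0:ℝ) 1) =>
        ENNReal.ofReal (zetaW φ (Measure.dirac α) c)) α hα)
    rw [hζα, zetaW_dirac φ hα.2.le]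
    split_ifs with h
    · refine one_div_le_one_div_of_le hI ?_
      rcases h.eq_or_lt with rfl | h
      · exact le_rfl
      · exact (intervalIntegral_to_one_lt hφpos hφint hc.1.le h hα.2.le).le
    · rw [zero_div]
      positivity
  · rw [hζα]
    exact one_div_lt_one_div_of_lt hI
      (intervalIntegral_to_one_lt hφpos hφint le_rfl hα.1 hα.2.le)
  · exact feasibleW_step hφmeas hφpos hφint hα (by positivity) (mul_div_cancel₀ x hI.ne').le
  · simp [objVal_dirac hα]
  · intro G hG
    rw [objVal_dirac hα, objVal_dirac hα, if_pos le_rfl]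
    refine ENNReal.ofReal_le_ofReal ((le_div_iff₀' hI).2 ?_)
    exact hG.integral_mul_le hφmeas hφpos hφint hx.le hα
end
end
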